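/- Let X be a finite set, p a probability distribution on X, fix ε ∈ (0, 1/n), let D_{n,ε} be the set of n×n density matrices with all eigenvalues at least ε, and let Γ be a nonempty, convex, compact subset of the product (D_{n,ε})^X. Consider the conditional log loss L(ρ,σ) := ∑_{x∈X} p(x)·(−Tr(ρ_x log σ_x)) for ρ, σ ∈ (D_{n,ε})^X. Then: (i) inf_{σ ∈ (D_{n,ε})^X} sup_{ρ ∈ Γ} L(ρ,σ) = sup_{ρ ∈ Γ} inf_{σ ∈ (D_{n,ε})^X} L(ρ,σ); (ii) a saddle point (ρ*, σ*) exists; and (iii) ρ* maximizes the conditional von Neumann entropy ∑_{x∈X} p(x)·S(ρ_x) over Γ, with this maximum equal to the minimax value. -/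

import Mathlib

open Matrix

/-- The matrix logarithm of a real symmetric matrix, defined by applying `Real.log` to
the eigenvalues in a spectral decomposition (junk value `0` for non-Hermitian input). -/
noncomputable def matLog {n : ℕ} (A : Matrix (Fin n) (Fin n) ℝ) :
    Matrix (Fin n) (Fin n) ℝ :=
  if h : A.IsHermitian then h.cfc Real.log else 0

/-- The von Neumann entropy `S(ρ) := −∑ᵢ λᵢ log λᵢ` of a real symmetric matrix `ρ` with
eigenvalues `λᵢ`, with the convention `0 · log 0 = 0` (note `Real.log 0 = 0`). Junk value
`0` for non-Hermitian input. -/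
noncomputable def vnEntropy {n : ℕ} (ρ : Matrix (Fin n) (Fin n) ℝ) : ℝ :=
  if h : ρ.IsHermitian then -∑ i, h.eigenvalues i * Real.log (h.eigenvalues i) else 0

/-- `D_{n,ε}`: the set of n×n density matrices ρ (real symmetric PSD, trace 1) with
ρ − εI positive semidefinite. -/
def Dset (n : ℕ) (ε : ℝ) : Set (Matrix (Fin n) (Fin n) ℝ) :=
  {ρ | ρ.PosSemidef ∧ ρ.trace = 1 ∧ (ρ - ε • 1).PosSemidef}

/-- The set of families (indexed by X) of matrices all lying in `D_{n,ε}`. -/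
def DFam (X : Type*) (n : ℕ) (ε : ℝ) : Set (X → Matrix (Fin n) (Fin n) ℝ) :=
  {σ | ∀ x, σ x ∈ Dset n ε}

/-- The conditional log loss `L(ρ,σ) := ∑_x p(x)·(−Tr(ρ_x log σ_x))`. -/
noncomputable def condLogLoss {n : ℕ} {X : Type*} [Fintype X] (p : X → ℝ)
    (ρ σ : X → Matrix (Fin n) (Fin n) ℝ) : ℝ :=
  ∑ x, p x * -(ρ x * matLog (σ x)).trace

namespace Matrix.IsHermitian

variable {m : Type*} [Fintype m] [DecidableEq m] {A B : Matrix m m ℝ}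

lemma cfc_eq_mul_diagonal_mul (hA : A.IsHermitian) (f : ℝ → ℝ) :
    hA.cfc f = (hA.eigenvectorUnitary : Matrix m m ℝ) * diagonal (f ∘ hA.eigenvalues) *
      star (hA.eigenvectorUnitary : Matrix m m ℝ) := by
  rw [IsHermitian.cfc, Unitary.conjStarAlgAut_apply]
  rfl

lemma cfc_apply_eq_sum (hA : A.IsHermitian) (f : ℝ → ℝ) (i j : m) :
    hA.cfc f i j = ∑ k, (hA.eigenvectorUnitary : Matrix m m ℝ) i k * f (hA.eigenvalues k) *
      (hA.eigenvectorUnitary : Matrix m m ℝ) j k := by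
  rw [cfc_eq_mul_diagonal_mul, mul_apply]
  simp [mul_diagonal, star_apply]

lemma cfc_self (hA : A.IsHermitian) : hA.cfc id = A := by
  rw [← hA.cfc_eq]
  exact cfc_id ℝ A hA

lemma cfc_const_one (hA : A.IsHermitian) : hA.cfc (fun _ ↦ 1) = 1 := by
  rw [← hA.cfc_eq]
  exact cfc_one ℝ A hA

lemma trace_cfc (hA : A.IsHermitian) (f : ℝ → ℝ) :
    (hA.cfc f).trace = ∑ i, f (hA.eigenvalues i) := by
  rw [cfc_eq_mul_diagonal_mul, trace_mul_cycle, Unitary.coe_star_mul_self, one_mul, trace_diagonal]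
  rfl

lemma cfc_mul_cfc (hA : A.IsHermitian) (f g : ℝ → ℝ) :
    hA.cfc f * hA.cfc g = hA.cfc (fun t ↦ f t * g t) := by
  simp only [cfc_eq_mul_diagonal_mul, ← Matrix.mul_assoc]
  rw [Matrix.mul_assoc _ (star _) _, Unitary.coe_star_mul_self, Matrix.mul_one,
    Matrix.mul_assoc _ (diagonal _) (diagonal _), diagonal_mul_diagonal]
  rfl

lemma trace_cfc_mul_cfc (hA : A.IsHermitian) (hB : B.IsHermitian) (f g : ℝ → ℝ) :
    (hA.cfc f * hB.cfc g).trace = ∑ i, ∑ j, f (hA.eigenvalues i) * g (hB.eigenvalues j) *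
      ((star (hA.eigenvectorUnitary : Matrix m m ℝ) *
        (hB.eigenvectorUnitary : Matrix m m ℝ)) i j) ^ 2 := by
  set U := (hA.eigenvectorUnitary : Matrix m m ℝ)
  set V := (hB.eigenvectorUnitary : Matrix m m ℝ)
  have h : (hA.cfc f * hB.cfc g).trace =
      ((diagonal (f ∘ hA.eigenvalues) * (star U * V)) *
        (diagonal (g ∘ hB.eigenvalues) * star (star U * V))).trace := by
    rw [cfc_eq_mul_diagonal_mul, cfc_eq_mul_diagonal_mul, star_mul, star_star, Matrix.mul_assoc,
      Matrix.mul_assoc, trace_mul_comm]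
    simp only [Matrix.mul_assoc, U, V]
  rw [h, trace]
  refine Finset.sum_congr rfl fun i _ ↦ ?_
  rw [diag_apply, mul_apply]
  refine Finset.sum_congr rfl fun j _ ↦ ?_
  simp only [diagonal_mul, star_apply, star_trivial, Function.comp_apply]
  ring

lemma le_eigenvalues_of_posSemidef_sub (hA : A.IsHermitian) {c : ℝ}
    (h : (A - c • (1 : Matrix m m ℝ)).PosSemidef) (i : m) : c ≤ hA.eigenvalues i := by
  have h1 := (h.conjTranspose_mul_mul_same
    (hA.eigenvectorUnitary : Matrix m m ℝ)).diag_nonneg (i := i)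
  have h2 := hA.conjStarAlgAut_star_eigenvectorUnitary
  rw [Unitary.conjStarAlgAut_star_apply] at h2
  rw [← star_eq_conjTranspose, Matrix.mul_sub, Matrix.sub_mul, h2] at h1
  simpa using h1

/-- **Klein's inequality** for positive definite real matrices. -/
lemma trace_sub_trace_le_trace_mul_log_sub (hA : A.IsHermitian) (hB : B.IsHermitian)
    (hA0 : ∀ i, 0 < hA.eigenvalues i) (hB0 : ∀ i, 0 < hB.eigenvalues i) :
    A.trace - B.trace ≤ (A * hA.cfc Real.log).trace - (A * hB.cfc Real.log).trace := by
  have e1 : (A * hA.cfc Real.log).trace =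
      (hA.cfc (fun t ↦ t * Real.log t) * hB.cfc (fun _ ↦ 1)).trace := by
    nth_rw 1 [← hA.cfc_self]
    rw [cfc_mul_cfc, cfc_const_one, mul_one]
    rfl
  have e2 : (A * hB.cfc Real.log).trace = (hA.cfc id * hB.cfc Real.log).trace := by
    rw [hA.cfc_self]
  have e3 : A.trace = (hA.cfc id * hB.cfc (fun _ ↦ 1)).trace := by
    rw [hA.cfc_self, cfc_const_one, mul_one]
  have e4 : B.trace = (hA.cfc (fun _ ↦ 1) * hB.cfc id).trace := by
    rw [hB.cfc_self, cfc_const_one, one_mul]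
  rw [e1, e2, e3, e4]
  simp only [trace_cfc_mul_cfc, ← Finset.sum_sub_distrib, ← sub_mul]
  refine Finset.sum_le_sum fun i _ ↦ Finset.sum_le_sum fun j _ ↦
    mul_le_mul_of_nonneg_right ?_ (sq_nonneg _)
  have ha := hA0 i
  have hb := hB0 j
  have h := Real.log_le_sub_one_of_pos (div_pos hb ha)
  rw [Real.log_div hb.ne' ha.ne'] at h
  have h' := mul_le_mul_of_nonneg_left h ha.le
  rw [mul_sub, mul_sub, mul_div_cancel₀ _ ha.ne'] at h'
  simp only [id]
  linarith

lemma abs_cfc_apply_sub_cfc_apply_le (hA : A.IsHermitian) {f g : ℝ → ℝ} {δ : ℝ}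
    (h : ∀ i, |f (hA.eigenvalues i) - g (hA.eigenvalues i)| ≤ δ) (i j : m) :
    |hA.cfc f i j - hA.cfc g i j| ≤ Fintype.card m * δ := by
  have hU : ∀ i k, |(hA.eigenvectorUnitary : Matrix m m ℝ) i k| ≤ 1 := fun i k ↦
    entry_norm_bound_of_unitary hA.eigenvectorUnitary.2 i k
  rw [cfc_apply_eq_sum, cfc_apply_eq_sum, ← Finset.sum_sub_distrib]
  refine (Finset.abs_sum_le_sum_abs _ _).trans ?_
  rw [← nsmul_eq_mul, ← Finset.card_univ]
  refine Finset.sum_le_card_nsmul _ _ _ fun k _ ↦ ?_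
  rw [← sub_mul, ← mul_sub, abs_mul, abs_mul]
  calc _ ≤ 1 * δ * 1 := by
        have := (abs_nonneg _).trans (h k)
        gcongr
        exacts [hU i k, h k, hU j k]
    _ = δ := by ring

end Matrix.IsHermitian

section Dset

variable {n : ℕ} {ε : ℝ} {ρ σ : Matrix (Fin n) (Fin n) ℝ}

lemma isHermitian_of_mem_Dset (hρ : ρ ∈ Dset n ε) : ρ.IsHermitian :=
  hρ.1.isHermitian

lemma le_eigenvalues_of_mem_Dset (hρ : ρ ∈ Dset n ε) (i : Fin n) :
    ε ≤ (isHermitian_of_mem_Dset hρ).eigenvalues i :=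
  (isHermitian_of_mem_Dset hρ).le_eigenvalues_of_posSemidef_sub hρ.2.2 i

lemma eigenvalues_le_one_of_mem_Dset (hρ : ρ ∈ Dset n ε) (i : Fin n) :
    (isHermitian_of_mem_Dset hρ).eigenvalues i ≤ 1 := by
  have h := (isHermitian_of_mem_Dset hρ).trace_eq_sum_eigenvalues
  rw [hρ.2.1] at h
  rw [show (1 : ℝ) = ∑ i, (isHermitian_of_mem_Dset hρ).eigenvalues i by simpa using h]
  exact Finset.single_le_sum (fun j _ ↦ hρ.1.eigenvalues_nonneg j) (Finset.mem_univ i)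

lemma matLog_of_mem_Dset (hρ : ρ ∈ Dset n ε) :
    matLog ρ = (isHermitian_of_mem_Dset hρ).cfc Real.log :=
  dif_pos _

lemma vnEntropy_eq_neg_trace_mul_matLog (hρ : ρ ∈ Dset n ε) :
    vnEntropy ρ = -(ρ * matLog ρ).trace := by
  have h := isHermitian_of_mem_Dset hρ
  rw [vnEntropy, dif_pos h, matLog_of_mem_Dset hρ]
  congr 1
  nth_rw 3 [← h.cfc_self]
  rw [h.cfc_mul_cfc, h.trace_cfc]
  rfl

lemma vnEntropy_le_neg_trace_mul_matLog (hε : 0 < ε) (hρ : ρ ∈ Dset n ε) (hσ : σ ∈ Dset n ε) :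
    vnEntropy ρ ≤ -(ρ * matLog σ).trace := by
  have h := (isHermitian_of_mem_Dset hρ).trace_sub_trace_le_trace_mul_log_sub
    (isHermitian_of_mem_Dset hσ) (fun i ↦ hε.trans_le (le_eigenvalues_of_mem_Dset hρ i))
    (fun i ↦ hε.trans_le (le_eigenvalues_of_mem_Dset hσ i))
  rw [hρ.2.1, hσ.2.1, sub_self, ← matLog_of_mem_Dset hρ, ← matLog_of_mem_Dset hσ] at h
  rw [vnEntropy_eq_neg_trace_mul_matLog hρ]
  linarith

lemma continuousOn_matLog (hε : 0 < ε) : ContinuousOn (matLog (n := n)) (Dset n ε) := by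
  refine continuousOn_pi.2 fun i ↦ continuousOn_pi.2 fun j ↦
    continuousOn_of_uniform_approx_of_continuousOn fun u hu ↦ ?_
  obtain ⟨δ, hδ, hu⟩ := Metric.mem_uniformity_dist.1 hu
  obtain ⟨q, hq⟩ := exists_polynomial_near_of_continuousOn ε 1 Real.log
    (Real.continuousOn_log.mono fun t ht ↦ (hε.trans_le ht.1).ne') (δ / (n + 1)) (by positivity)
  refine ⟨fun ρ ↦ Polynomial.aeval ρ q i j, ?_, fun ρ hρ ↦ hu ?_⟩
  · exact ((q.continuous_aeval (A := Matrix (Fin n) (Fin n) ℝ)).matrix_elem i j).continuousOn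
  · have h := isHermitian_of_mem_Dset hρ
    have h1 : Polynomial.aeval ρ q = h.cfc q.eval := by
      rw [← h.cfc_eq, cfc_polynomial (p := IsSelfAdjoint) q ρ h]
    rw [matLog_of_mem_Dset hρ, dist_comm, Real.dist_eq]
    simp only [h1]
    refine (h.abs_cfc_apply_sub_cfc_apply_le (δ := δ / (n + 1)) (fun k ↦ (hq _
      ⟨le_eigenvalues_of_mem_Dset hρ k, eigenvalues_le_one_of_mem_Dset hρ k⟩).le) i j).trans_lt ?_
    rw [Fintype.card_fin, mul_div_assoc', div_lt_iff₀ (by positivity)]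
    nlinarith

end Dset

section CondLogLoss

variable {n : ℕ} {X : Type*} [Fintype X] {p : X → ℝ} {ε : ℝ}
  {ρ ρ' σ : X → Matrix (Fin n) (Fin n) ℝ}

lemma condLogLoss_self (hρ : ρ ∈ DFam X n ε) :
    condLogLoss p ρ ρ = ∑ x, p x * vnEntropy (ρ x) :=
  Finset.sum_congr rfl fun x _ ↦ by rw [vnEntropy_eq_neg_trace_mul_matLog (hρ x)]

lemma condLogLoss_self_le (hp0 : ∀ x, 0 ≤ p x) (hε : 0 < ε) (hρ : ρ ∈ DFam X n ε)
    (hσ : σ ∈ DFam X n ε) : condLogLoss p ρ ρ ≤ condLogLoss p ρ σ := by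
  rw [condLogLoss_self hρ]
  exact Finset.sum_le_sum fun x _ ↦ mul_le_mul_of_nonneg_left
    (vnEntropy_le_neg_trace_mul_matLog hε (hρ x) (hσ x)) (hp0 x)

lemma condLogLoss_combo (a b : ℝ) :
    condLogLoss p (a • ρ + b • ρ') σ = a * condLogLoss p ρ σ + b * condLogLoss p ρ' σ := by
  simp only [condLogLoss, Finset.mul_sum, ← Finset.sum_add_distrib]
  refine Finset.sum_congr rfl fun x _ ↦ ?_
  simp only [Pi.add_apply, Pi.smul_apply, add_mul, smul_mul, trace_add, trace_smul, smul_eq_mul]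
  ring

lemma continuousOn_condLogLoss (p : X → ℝ) (hε : 0 < ε) :
    ContinuousOn (fun q : (X → Matrix (Fin n) (Fin n) ℝ) × (X → Matrix (Fin n) (Fin n) ℝ) ↦
      condLogLoss p q.1 q.2) (Set.univ ×ˢ DFam X n ε) := by
  refine continuousOn_finsetSum _ fun x _ ↦ continuousOn_const.mul (ContinuousOn.neg ?_)
  have h1 : ContinuousOn
      (fun q : (X → Matrix (Fin n) (Fin n) ℝ) × (X → Matrix (Fin n) (Fin n) ℝ) ↦
        matLog (q.2 x)) (Set.univ ×ˢ DFam X n ε) :=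
    (continuousOn_matLog hε).comp (by fun_prop) fun q hq ↦ hq.2 x
  have h2 : Continuous
      (fun q : (X → Matrix (Fin n) (Fin n) ℝ) × (X → Matrix (Fin n) (Fin n) ℝ) ↦ q.1 x) := by
    fun_prop
  exact (continuous_id.matrix_trace).comp_continuousOn (h2.continuousOn.mul h1)

lemma continuous_condLogLoss_left (p : X → ℝ) (σ : X → Matrix (Fin n) (Fin n) ℝ) :
    Continuous (fun ρ ↦ condLogLoss p ρ σ) := by
  unfold condLogLoss
  fun_prop

/-- A maximizer of the conditional entropy over a convex set is a best response to itself. -/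
lemma condLogLoss_le_of_isMaxOn (hp0 : ∀ x, 0 ≤ p x) (hε : 0 < ε)
    {Γ : Set (X → Matrix (Fin n) (Fin n) ℝ)} (hΓsub : Γ ⊆ DFam X n ε) (hΓconv : Convex ℝ Γ)
    (hρ : ρ ∈ Γ) (hmax : IsMaxOn (fun ρ ↦ condLogLoss p ρ ρ) Γ ρ) (hρ' : ρ' ∈ Γ) :
    condLogLoss p ρ' ρ ≤ condLogLoss p ρ ρ := by
  set γ : ℝ → X → Matrix (Fin n) (Fin n) ℝ := fun t ↦ (1 - t) • ρ + t • ρ' with hγ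
  have hmem : ∀ t ∈ Set.Icc (0 : ℝ) 1, γ t ∈ Γ := fun t ht ↦
    hΓconv hρ hρ' (by linarith [ht.2]) ht.1 (by ring)
  have hle : ∀ t ∈ Set.Ioc (0 : ℝ) 1, condLogLoss p ρ' (γ t) ≤ condLogLoss p ρ ρ := by
    intro t ht
    have hγt := hmem t (Set.Ioc_subset_Icc_self ht)
    have h1 : condLogLoss p (γ t) (γ t) ≤ condLogLoss p ρ ρ := hmax hγt
    have h2 := condLogLoss_self_le hp0 hε (hΓsub hρ) (hΓsub hγt)
    have h3 : condLogLoss p (γ t) (γ t) =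
      (1 - t) * condLogLoss p ρ (γ t) + t * condLogLoss p ρ' (γ t) := condLogLoss_combo _ _
    have h4 := mul_le_mul_of_nonneg_left h2 (sub_nonneg.2 ht.2)
    exact le_of_mul_le_mul_left (by linarith) ht.1
  have hcont : ContinuousOn (fun t ↦ condLogLoss p ρ' (γ t)) (Set.Icc 0 1) :=
    (continuousOn_condLogLoss p hε).comp (f := fun t ↦ (ρ', γ t))
      (Continuous.continuousOn (by fun_prop)) fun t ht ↦ ⟨trivial, hΓsub (hmem t ht)⟩
  have hlim := ((hcont 0 (by simp)).mono Set.Ioc_subset_Icc_self).tendsto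
  have hγ0 : γ 0 = ρ := by simp [hγ]
  rw [hγ0] at hlim
  have : (nhdsWithin (0 : ℝ) (Set.Ioc 0 1)).NeBot := by
    rw [← mem_closure_iff_nhdsWithin_neBot, closure_Ioc zero_ne_one]
    simp
  exact le_of_tendsto hlim (eventually_mem_nhdsWithin.mono hle)

end CondLogLoss

/-- maximum conditional VNE as a minimax equilibrium: for a finite set X,
a probability distribution p on X, ε ∈ (0, 1/n), and Γ a nonempty convex compact subset
of (D_{n,ε})^X, the conditional log loss satisfies: (i) minimax equality over
σ ∈ (D_{n,ε})^X and ρ ∈ Γ; (ii) a saddle point (ρ*, σ*) exists; and (iii) ρ* maximizes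
the conditional von Neumann entropy ∑_x p(x)·S(ρ_x) over Γ, with the maximum equal to
the minimax value. -/
theorem conditional_maxVNE_minimax {n : ℕ} {X : Type*} [Fintype X]
    (p : X → ℝ) (hp0 : ∀ x, 0 ≤ p x) (hp1 : ∑ x, p x = 1)
    (ε : ℝ) (hε : ε ∈ Set.Ioo 0 (1 / (n : ℝ)))
    (Γ : Set (X → Matrix (Fin n) (Fin n) ℝ)) (hΓsub : Γ ⊆ DFam X n ε)
    (hΓne : Γ.Nonempty) (hΓconv : Convex ℝ Γ) (hΓcomp : IsCompact Γ) :
    (⨅ σ : DFam X n ε, ⨆ ρ : Γ, condLogLoss p ρ.1 σ.1) =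
      (⨆ ρ : Γ, ⨅ σ : DFam X n ε, condLogLoss p ρ.1 σ.1) ∧
    ∃ ρs ∈ Γ, ∃ σs ∈ DFam X n ε,
      (∀ ρ ∈ Γ, condLogLoss p ρ σs ≤ condLogLoss p ρs σs) ∧
      (∀ σ ∈ DFam X n ε, condLogLoss p ρs σs ≤ condLogLoss p ρs σ) ∧
      (∀ ρ ∈ Γ, (∑ x, p x * vnEntropy (ρ x)) ≤ ∑ x, p x * vnEntropy (ρs x)) ∧
      (∑ x, p x * vnEntropy (ρs x)) =
        ⨅ σ : DFam X n ε, ⨆ ρ : Γ, condLogLoss p ρ.1 σ.1 := by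
  have hε0 := hε.1
  have hcont : ContinuousOn (fun ρ ↦ condLogLoss p ρ ρ) Γ :=
    (continuousOn_condLogLoss p hε0).comp (f := fun ρ ↦ (ρ, ρ))
      (Continuous.continuousOn (by fun_prop)) fun ρ hρ ↦ ⟨trivial, hΓsub hρ⟩
  obtain ⟨ρs, hρs, hmax⟩ := hΓcomp.exists_isMaxOn hΓne hcont
  have hbest : ∀ ρ ∈ Γ, condLogLoss p ρ ρs ≤ condLogLoss p ρs ρs := fun ρ hρ ↦
    condLogLoss_le_of_isMaxOn hp0 hε0 hΓsub hΓconv hρs hmax hρ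
  have hklein : ∀ ρ ∈ Γ, ∀ σ ∈ DFam X n ε, condLogLoss p ρ ρ ≤ condLogLoss p ρ σ :=
    fun ρ hρ σ hσ ↦ condLogLoss_self_le hp0 hε0 (hΓsub hρ) hσ
  have : Nonempty Γ := ⟨⟨ρs, hρs⟩⟩
  have : Nonempty (DFam X n ε) := ⟨⟨ρs, hΓsub hρs⟩⟩
  have hbdd : ∀ σ, BddAbove (Set.range fun ρ : Γ ↦ condLogLoss p ρ.1 σ) := fun σ ↦ by
    have h := hΓcomp.bddAbove_image (continuous_condLogLoss_left p σ).continuousOn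
    rwa [Set.image_eq_range] at h
  have hsup : ∀ σ : DFam X n ε, condLogLoss p ρs ρs ≤ ⨆ ρ : Γ, condLogLoss p ρ.1 σ.1 :=
    fun σ ↦ (hklein ρs hρs σ.1 σ.2).trans (le_ciSup (hbdd σ.1) ⟨ρs, hρs⟩)
  have hinf : ∀ ρ : Γ, ⨅ σ : DFam X n ε, condLogLoss p ρ.1 σ.1 = condLogLoss p ρ.1 ρ.1 := by
    intro ρ
    have hlb : ∀ σ : DFam X n ε, condLogLoss p ρ.1 ρ.1 ≤ condLogLoss p ρ.1 σ.1 :=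
      fun σ ↦ hklein ρ.1 ρ.2 σ.1 σ.2
    exact le_antisymm (ciInf_le ⟨_, Set.forall_mem_range.2 hlb⟩ ⟨ρ.1, hΓsub ρ.2⟩) (le_ciInf hlb)
  have hinfsup : ⨅ σ : DFam X n ε, ⨆ ρ : Γ, condLogLoss p ρ.1 σ.1 = condLogLoss p ρs ρs :=
    le_antisymm ((ciInf_le ⟨_, Set.forall_mem_range.2 hsup⟩ ⟨ρs, hΓsub hρs⟩).trans
      (ciSup_le fun ρ ↦ hbest ρ.1 ρ.2)) (le_ciInf hsup)
  have hsupinf : ⨆ ρ : Γ, ⨅ σ : DFam X n ε, condLogLoss p ρ.1 σ.1 = condLogLoss p ρs ρs := by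
    simp only [hinf]
    have hub : ∀ ρ : Γ, condLogLoss p ρ.1 ρ.1 ≤ condLogLoss p ρs ρs := fun ρ ↦ hmax ρ.2
    exact le_antisymm (ciSup_le hub) (le_ciSup (f := fun ρ : Γ ↦ condLogLoss p ρ.1 ρ.1)
      ⟨_, Set.forall_mem_range.2 hub⟩ ⟨ρs, hρs⟩)
  refine ⟨hinfsup.trans hsupinf.symm, ρs, hρs, ρs, hΓsub hρs, hbest, hklein ρs hρs,
    fun ρ hρ ↦ ?_, ?_⟩
  · rw [← condLogLoss_self (hΓsub hρ), ← condLogLoss_self (hΓsub hρs)]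
    exact hmax hρ
  · rw [← condLogLoss_self (hΓsub hρs), hinfsup]
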